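/- arXiv:1106.1551 — 6 statements merged into one kernel-verified Lean document; each statement's English description precedes it below -/
import Mathlib

section
/- Let π : A → B be a surjective *-homomorphism between C*-algebras and let I = ker π. Let p and q be projections in A such that π(p) ∼ π(q) in B, and suppose that the corner pIp = {pxp : x ∈ I} has an approximate identity consisting of projections. Then there exist projections p₁ and e₁ in A with p₁ ≤ p, e₁ ≤ q, p₁ ∼ e₁ in A, π(p₁) = π(p), and π(e₁) = π(q). -/
/-- In the corner of a projection `g`, the element `g - d` with `d = d*` and `‖d‖ < 1` has an
inverse square root `g + w`, where `w` lies in the right ideal generated by `d`. -/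
theorem IsStarProjection.exists_mul_sub_mul_eq {A : Type*} [NonUnitalCStarAlgebra A]
    {g d : A} (hg : IsStarProjection g) (hd : IsSelfAdjoint d) (hgd : g * d = d)
    (hnorm : ‖d‖ < 1) :
    ∃ w : A, (∃ (r : ℝ) (k : A), w = r • d + d * k) ∧ star w = w ∧ g * w = w ∧
      (g + w) * (g - d) * (g + w) = g := by
  have hlt : ∀ t ∈ quasispectrum ℝ d, t < 1 := fun t ht =>
    (le_abs_self t).trans_lt
      ((NonUnitalIsometricContinuousFunctionalCalculus.norm_quasispectrum_le d ht).trans_lt hnorm)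
  have hs : ContinuousOn (fun t : ℝ => √(1 - t)) (quasispectrum ℝ d) := by fun_prop
  have hs0 : ∀ t ∈ quasispectrum ℝ d, 0 < √(1 - t) := fun t ht =>
    Real.sqrt_pos.2 (by linarith [hlt t ht])
  let χ : ℝ → ℝ := fun t => (√(1 - t) * (1 + √(1 - t)))⁻¹ - 1 / 2
  let φ : ℝ → ℝ := fun t => 1 / 2 * t + t * χ t
  have hχ : ContinuousOn χ (quasispectrum ℝ d) :=
    ((hs.mul (continuousOn_const.add hs)).inv₀ fun t ht =>
      (mul_pos (hs0 t ht) (add_pos one_pos (hs0 t ht))).ne').sub continuousOn_const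
  have hφ : ContinuousOn φ (quasispectrum ℝ d) :=
    (continuousOn_const.mul continuousOn_id).add (continuousOn_id.mul hχ)
  have hχ0 : χ 0 = 0 := by norm_num [χ]
  have hφ0 : φ 0 = 0 := by simp [φ]
  have hcfc : cfcₙ φ d = (1 / 2 : ℝ) • d + d * cfcₙ χ d := by
    simp only [φ]
    rw [cfcₙ_add (a := d) (fun t => 1 / 2 * t) (fun t => t * χ t)
      (by fun_prop) (by simp) (continuousOn_id.mul hχ) (by simp),
      cfcₙ_const_mul_id (1 / 2 : ℝ) d, cfcₙ_mul (a := d) (fun t => t) χ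
      (by fun_prop) rfl hχ hχ0, cfcₙ_id' ℝ d]
  have hφval : ∀ t ∈ quasispectrum ℝ d,
      φ t + (φ t + φ t * φ t) = t + (t * φ t + (φ t * t + φ t * t * φ t)) := fun t ht => by
    have h0 := hs0 t ht
    have hsq : √(1 - t) ^ 2 = 1 - t := Real.sq_sqrt (by linarith [hlt t ht])
    have hφt : φ t = (√(1 - t))⁻¹ - 1 := by
      simp only [φ, χ]
      generalize √(1 - t) = s at *
      obtain rfl : t = 1 - s ^ 2 := by linarith
      field_simp
      ring
    rw [hφt]
    generalize √(1 - t) = s at *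
    obtain rfl : t = 1 - s ^ 2 := by linarith
    field_simp
    ring
  have hid : cfcₙ φ d + (cfcₙ φ d + cfcₙ φ d * cfcₙ φ d)
      = d + (d * cfcₙ φ d + (cfcₙ φ d * d + cfcₙ φ d * d * cfcₙ φ d)) := by
    have h := cfcₙ_congr hφval
    have hi : ContinuousOn (fun t : ℝ => t) (quasispectrum ℝ d) := continuousOn_id
    rwa [cfcₙ_add (a := d) φ (fun t => φ t + φ t * φ t) hφ hφ0
        (hφ.add (hφ.mul hφ)) (by simp [hφ0]),
      cfcₙ_add (a := d) φ (fun t => φ t * φ t) hφ hφ0 (hφ.mul hφ) (by simp [hφ0]),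
      cfcₙ_mul (a := d) φ φ hφ hφ0 hφ hφ0,
      cfcₙ_add (a := d) (fun t => t) (fun t => t * φ t + (φ t * t + φ t * t * φ t)) hi rfl
        ((hi.mul hφ).add ((hφ.mul hi).add ((hφ.mul hi).mul hφ))) (by simp),
      cfcₙ_add (a := d) (fun t => t * φ t) (fun t => φ t * t + φ t * t * φ t) (hi.mul hφ) (by simp)
        ((hφ.mul hi).add ((hφ.mul hi).mul hφ)) (by simp),
      cfcₙ_add (a := d) (fun t => φ t * t) (fun t => φ t * t * φ t) (hφ.mul hi) (by simp)
        ((hφ.mul hi).mul hφ) (by simp),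
      cfcₙ_mul (a := d) (fun t => φ t * t) φ (hφ.mul hi) (by simp) hφ hφ0,
      cfcₙ_mul (a := d) (fun t => t) φ hi rfl hφ hφ0,
      cfcₙ_mul (a := d) φ (fun t => t) hφ hφ0 hi rfl, cfcₙ_id' ℝ d] at h
  have hsa : star (cfcₙ φ d) = cfcₙ φ d := cfcₙ_predicate φ d
  have hgw : g * cfcₙ φ d = cfcₙ φ d := by
    rw [hcfc, mul_add, mul_smul_comm, ← mul_assoc, hgd]
  refine ⟨cfcₙ φ d, ⟨1 / 2, cfcₙ χ d, hcfc⟩, hsa, hgw, ?_⟩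
  generalize cfcₙ φ d = w at *
  have hgs : star g = g := hg.isSelfAdjoint
  have hwg : w * g = w := by
    have := congrArg star hgw
    rwa [star_mul, hsa, hgs] at this
  have hdg : d * g = d := by
    have := congrArg star hgd
    rwa [star_mul, hd.star_eq, hgs] at this
  have hgg : g * g = g := hg.isIdempotentElem
  calc (g + w) * (g - d) * (g + w)
      = g + (w + (w + w * w)) - (d + (d * w + (w * d + w * d * w))) := by
        simp only [mul_add, add_mul, mul_sub, sub_mul, hgg, hgd, hdg, hgw, hwg, mul_assoc]
        abel
    _ = g := by rw [hid]; abel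


theorem CStarRing.mul_star_mul_self_of_isIdempotentElem {A : Type*} [NonUnitalNormedRing A]
    [StarRing A] [CStarRing A] {v : A} (hv : IsIdempotentElem (star v * v)) :
    v * (star v * v) = v := by
  rw [← sub_eq_zero, ← CStarRing.star_mul_self_eq_zero_iff]
  have h : star v * v * (star v * v) = star v * v := hv
  simp only [star_sub, star_mul, star_star, mul_sub, sub_mul]
  simp only [mul_assoc] at h ⊢
  simp [h]

/-- Let `π : A → B` be a surjective *-homomorphism between C*-algebras with
kernel `I`.  Let `p`, `q` be projections in `A` with `π p ∼ π q` in `B`, and suppose the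
corner `p I p = {p x p : x ∈ I}` has an approximate identity consisting of projections.
Then there exist projections `p₁ ≤ p` and `e₁ ≤ q` in `A` with `p₁ ∼ e₁`,
`π p₁ = π p` and `π e₁ = π q`. -/
theorem lift_murray_von_neumann_equivalence
    {A B : Type*} [NonUnitalCStarAlgebra A] [NonUnitalCStarAlgebra B]
    (π : A →⋆ₙₐ[ℂ] B) (hsurj : Function.Surjective π)
    (p q : A)
    (hp₁ : star p = p) (hp₂ : p * p = p) (hq₁ : star q = q) (hq₂ : q * q = q)
    (hsim : ∃ v : B, star v * v = π p ∧ v * star v = π q)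
    (hAI : ∀ c : A, (∃ x : A, π x = 0 ∧ c = p * x * p) → ∀ ε : ℝ, 0 < ε →
      ∃ f : A, (∃ z : A, π z = 0 ∧ f = p * z * p) ∧ star f = f ∧ f * f = f ∧
        ‖c - f * c‖ < ε ∧ ‖c - c * f‖ < ε) :
    ∃ p₁ e₁ : A, star p₁ = p₁ ∧ p₁ * p₁ = p₁ ∧ star e₁ = e₁ ∧ e₁ * e₁ = e₁ ∧
      p * p₁ = p₁ ∧ q * e₁ = e₁ ∧ (∃ v : A, star v * v = p₁ ∧ v * star v = e₁) ∧
      π p₁ = π p ∧ π e₁ = π q := by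
  obtain ⟨v, hv, hv'⟩ := hsim
  obtain ⟨a, rfl⟩ := hsurj v
  have hpp : π p * π p = π p := by rw [← map_mul, hp₂]
  have hvp : π a * π p = π a := by
    rw [← hv]
    exact CStarRing.mul_star_mul_self_of_isIdempotentElem (by rwa [hv])
  have hqv : π q * π a = π a := by rw [← hv', mul_assoc, hv, hvp]
  set x := q * a * p with hx
  have hqx : q * x = x := by simp only [hx, ← mul_assoc, hq₂]
  have hxp : x * p = x := by simp only [hx, mul_assoc, hp₂]
  have hpx : p * star x = star x := by simpa [hp₁] using congrArg star hxp
  have hπx : π x = π a := by rw [hx, map_mul, map_mul, hqv, hvp]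
  set c := p - star x * x with hc
  have hcs : star c = c := by simp [hc, hp₁]
  have hπc : π c = 0 := by simp [hc, map_star, hπx, hv]
  have hpcp : c = p * c * p := by
    simp only [hc, mul_sub, sub_mul, hp₂, ← mul_assoc, hpx]
    simp only [mul_assoc, hxp]
  obtain ⟨f, ⟨z, hz, hfz⟩, hfs, hff, -, hcf⟩ := hAI c ⟨c, hπc, hpcp⟩ 1 one_pos
  have hpf : p * f = f := by simp only [hfz, ← mul_assoc, hp₂]
  have hfp : f * p = f := by simp only [hfz, mul_assoc, hp₂]
  have hπf : π f = 0 := by simp [hfz, hz]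
  have hcp : c * p = c := by rw [hpcp]; simp only [mul_assoc, hp₂]
  set g := p - f with hgdef
  have hgs : star g = g := by simp [hgdef, hp₁, hfs]
  have hgg : g * g = g := by simp [hgdef, mul_sub, sub_mul, hp₂, hpf, hfp, hff]
  have hpg : p * g = g := by simp [hgdef, mul_sub, hp₂, hpf]
  have hgp : g * p = g := by simp [hgdef, sub_mul, hp₂, hfp]
  have hπg : π g = π p := by simp [hgdef, hπf]
  have hg : IsStarProjection g := ⟨hgg, hgs⟩
  set d := g * c * g with hd
  have hdn : ‖d‖ < 1 := by
    have : c * g = c - c * f := by rw [hgdef, mul_sub, hcp]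
    calc ‖d‖ ≤ ‖g‖ * ‖c * g‖ := by rw [hd, mul_assoc]; exact norm_mul_le _ _
      _ ≤ 1 * ‖c * g‖ := by gcongr; exact hg.norm_le
      _ < 1 := by rwa [one_mul, this]
  have hds : IsSelfAdjoint d := by
    simp [IsSelfAdjoint, hd, hgs, hcs, mul_assoc]
  obtain ⟨w, ⟨r, k, hw⟩, hws, hgw, hinv⟩ := hg.exists_mul_sub_mul_eq hds
    (by simp only [hd, ← mul_assoc, hgg]) hdn
  have hπd : π d = 0 := by simp [hd, hπc]
  have hπw : π w = 0 := by
    have : (r • d : A) = (r : ℂ) • d := (Complex.coe_smul r d).symm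
    rw [hw, this, map_add, map_smul, map_mul π d, hπd, smul_zero, zero_mul, add_zero]
  have hwg : w * g = w := by simpa [hws, hgs] using congrArg star hgw
  set h := g + w with hh
  have hhs : star h = h := by simp [hh, hgs, hws]
  have hgh : g * h = h := by simp [hh, mul_add, hgg, hgw]
  have hhg : h * g = h := by simp [hh, add_mul, hgg, hwg]
  have hπh : π h = π p := by simp [hh, hπw, hπg]
  have hgd : g - d = g * (star x * x) * g := by
    have : star x * x = p - c := by simp [hc]
    rw [this, mul_sub g, sub_mul, hgp, hgg]
  have huu : star (x * h) * (x * h) = g := by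
    rw [hgd] at hinv
    calc star (x * h) * (x * h) = (h * g) * (star x * x) * (g * h) := by
          rw [hhg, hgh, star_mul, hhs]; simp only [mul_assoc]
      _ = h * (g * (star x * x) * g) * h := by simp only [mul_assoc]
      _ = g := hinv
  have hπu : π (x * h) = π x := by rw [map_mul, hπh, ← map_mul, hxp]
  refine ⟨g, x * h * star (x * h), hgs, hgg, by simp, ?_, hpg, ?_, ⟨x * h, huu, rfl⟩, hπg, ?_⟩
  · have hug : x * h * g = x * h := by rw [mul_assoc, hhg]
    calc x * h * star (x * h) * (x * h * star (x * h))
        = x * h * (star (x * h) * (x * h)) * star (x * h) := by simp only [mul_assoc]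
      _ = x * h * star (x * h) := by rw [huu, hug]
  · simp only [← mul_assoc, hqx]
  · rw [map_mul, map_star, hπu, hπx, hv']
end

section
/- Let π : A → B be a surjective *-homomorphism between C*-algebras and let I = ker π. Let p and q be projections in A such that there exists a projection e in B with π(p) ∼ e in B, e ≤ π(q), and e ≠ π(q). Suppose that the corner pIp = {pxp : x ∈ I} has an approximate identity consisting of projections. Then there exist projections p₁ and e₁ in A with p₁ ≤ p, e₁ ≤ q, p₁ ∼ e₁ in A, π(p₁) = π(p), π(e₁) ≤ π(q), and π(e₁) ≠ π(q). -/
section CStarAlgebra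

variable {A B : Type*} [NonUnitalCStarAlgebra A] [NonUnitalCStarAlgebra B]

open scoped CStarAlgebra in
/-- In a non-unital C⋆-algebra, a self-adjoint `d` with `‖d‖ < 1` admits a self-adjoint `h`,
formally `(1 + d)^(-1/2) - 1`, commuting with the commutant of `d` and killed by every
⋆-homomorphism that kills `d`. The last equation reads `(1 + d) * (1 + h) ^ 2 = 1`. -/
lemma IsSelfAdjoint.exists_inv_sqrt_one_add_sub_one (π : A →⋆ₙₐ[ℂ] B) {d : A}
    (hd : IsSelfAdjoint d) (hnorm : ‖d‖ < 1) :
    ∃ h : A, IsSelfAdjoint h ∧ (∀ b, Commute d b → Commute h b) ∧ (π d = 0 → π h = 0) ∧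
      d + (h + h + h * h) + d * (h + h + h * h) = 0 := by
  let g : ℝ → ℝ := fun t ↦ (√(1 + t))⁻¹ - 1
  have hpos : ∀ t ∈ quasispectrum ℝ d, 0 < 1 + t := fun t ht ↦ by
    have := (NonUnitalIsometricContinuousFunctionalCalculus.norm_quasispectrum_le d ht hd).trans_lt
      hnorm
    linarith [(abs_lt.mp this).1]
  have hg0 : g 0 = 0 := by simp [g]
  have hg : ContinuousOn g (quasispectrum ℝ d) :=
    (ContinuousOn.inv₀ (by fun_prop) fun t ht ↦ (Real.sqrt_pos.mpr (hpos t ht)).ne').sub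
      continuousOn_const
  refine ⟨cfcₙ g d, IsSelfAdjoint.cfcₙ, fun b hb ↦ hb.cfcₙ_real g, fun h0 ↦ ?_, ?_⟩
  · rw [π.map_cfcₙ g d (ha := hd) (hφa := hd.map π), h0, cfcₙ_apply_zero]
  · have hk : cfcₙ (fun t ↦ g t + g t + g t * g t) d
        = cfcₙ g d + cfcₙ g d + cfcₙ g d * cfcₙ g d := by
      rw [cfcₙ_add (fun t ↦ g t + g t) (fun t ↦ g t * g t) d (by fun_prop) (by simp [hg0])
        (by fun_prop) (by simp [hg0]), cfcₙ_add g g d, cfcₙ_mul g g d]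
    have hkc : ContinuousOn (fun t ↦ g t + g t + g t * g t) (quasispectrum ℝ d) := by fun_prop
    have hk0 : g 0 + g 0 + g 0 * g 0 = 0 := by simp [hg0]
    rw [← hk]
    nth_rw 1 3 [← cfcₙ_id' ℝ d hd]
    rw [← cfcₙ_mul (fun t ↦ t) _ d, ← cfcₙ_add (fun t ↦ t) _ d,
      ← cfcₙ_add _ _ d (by fun_prop) (by simp [hg0]) (by fun_prop) (by simp),
      ← cfcₙ_zero ℝ d]
    refine cfcₙ_congr fun t ht ↦ ?_
    have hs := Real.sq_sqrt (hpos t ht).le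
    have hs0 := (Real.sqrt_pos.mpr (hpos t ht)).ne'
    simp only [g, Pi.zero_apply]
    field_simp
    linear_combination -hs

/-- If `x * r = x` for a projection `r` with `‖star x * x - r‖ < 1`, then `x` can be corrected to a
partial isometry with initial projection `r`; modulo the kernel of a ⋆-homomorphism `π`, no
correction is made where `star x * x` already agrees with `r`. -/
lemma exists_star_mul_self_eq_of_norm_sub_lt_one (π : A →⋆ₙₐ[ℂ] B) {r x : A}
    (hr : IsStarProjection r) (hxr : x * r = x) (hnorm : ‖star x * x - r‖ < 1) :
    ∃ y : A, star (x + x * y) * (x + x * y) = r ∧ (x + x * y) * r = x + x * y ∧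
      (π (star x * x) = π r → π y = 0) := by
  have hrs : star r = r := hr.isSelfAdjoint
  have hrr : r * r = r := hr.isIdempotentElem
  have hrx : r * star x = star x := by simpa [hrs] using congr(star $hxr)
  obtain ⟨d, hd⟩ : ∃ d, d = star x * x - r := ⟨_, rfl⟩
  have hxx : star x * x = r + d := by rw [hd]; abel
  have hdr : d * r = d := by rw [hd, sub_mul, mul_assoc, hxr, hrr]
  have hrd : r * d = d := by rw [hd, mul_sub, ← mul_assoc, hrx, hrr]
  have hdsa : IsSelfAdjoint d := hd ▸ (IsSelfAdjoint.star_mul_self x).sub hr.isSelfAdjoint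
  obtain ⟨h, hsa, hcomm, hπ, heq⟩ :=
    hdsa.exists_inv_sqrt_one_add_sub_one π (hd ▸ hnorm)
  have hhr : h * r = r * h := hcomm r (hdr.trans hrd.symm)
  have hhd : h * d = d * h := hcomm d (Commute.refl d)
  refine ⟨h, ?_, ?_, fun h0 ↦ hπ (by rw [hd, map_sub, h0, sub_self])⟩
  · have hsum : star (x + x * h) * (x + x * h)
        = star x * x + h * (star x * x) + star x * x * h + h * (star x * x) * h := by
      simp only [star_add, star_mul, hsa.star_eq]
      noncomm_ring
    calc star (x + x * h) * (x + x * h)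
        = r + r * (d + (h + h + h * h) + d * (h + h + h * h)) := by
          rw [hsum, hxx]
          simp only [mul_add, add_mul, ← mul_assoc, hrd, hhr, hhd]
          abel
      _ = r := by rw [heq, mul_zero, add_zero]
  · rw [add_mul, mul_assoc, hhr, ← mul_assoc, hxr]

end CStarAlgebra


/-- Let `π : A → B` be a surjective *-homomorphism between C*-algebras with
kernel `I`.  Let `p`, `q` be projections in `A` such that there is a projection `e` in `B`
with `π p ∼ e` in `B`, `e ≤ π q` (i.e. `π q * e = e`) and `e ≠ π q`.  Suppose the corner
`p I p = {p x p : x ∈ I}` has an approximate identity consisting of projections.  Then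
there exist projections `p₁ ≤ p` and `e₁ ≤ q` in `A` with `p₁ ∼ e₁`, `π p₁ = π p`,
`π e₁ ≤ π q` and `π e₁ ≠ π q`. -/
theorem lift_murray_von_neumann_strict_subequivalence
    {A B : Type*} [NonUnitalCStarAlgebra A] [NonUnitalCStarAlgebra B]
    (π : A →⋆ₙₐ[ℂ] B) (hsurj : Function.Surjective π)
    (p q : A)
    (hp₁ : star p = p) (hp₂ : p * p = p) (hq₁ : star q = q) (hq₂ : q * q = q)
    (hsub : ∃ e : B, star e = e ∧ e * e = e ∧
      (∃ v : B, star v * v = π p ∧ v * star v = e) ∧ π q * e = e ∧ e ≠ π q)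
    (hAI : ∀ c : A, (∃ x : A, π x = 0 ∧ c = p * x * p) → ∀ ε : ℝ, 0 < ε →
      ∃ f : A, (∃ z : A, π z = 0 ∧ f = p * z * p) ∧ star f = f ∧ f * f = f ∧
        ‖c - f * c‖ < ε ∧ ‖c - c * f‖ < ε) :
    ∃ p₁ e₁ : A, star p₁ = p₁ ∧ p₁ * p₁ = p₁ ∧ star e₁ = e₁ ∧ e₁ * e₁ = e₁ ∧
      p * p₁ = p₁ ∧ q * e₁ = e₁ ∧ (∃ v : A, star v * v = p₁ ∧ v * star v = e₁) ∧
      π p₁ = π p ∧ π q * π e₁ = π e₁ ∧ π e₁ ≠ π q := by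
  obtain ⟨e, -, -, ⟨v, hv, hve⟩, hqe, hne⟩ := hsub
  have hpp : IsStarProjection p := ⟨hp₂, hp₁⟩
  have hπp : IsStarProjection (π p) := hpp.map π
  have hvp : v * π p = v := by
    rw [← sub_eq_zero, ← CStarRing.star_mul_self_eq_zero_iff]
    have : star (v * π p - v) * (v * π p - v)
        = π p * (star v * v) * π p - π p * (star v * v) - (star v * v) * π p + star v * v := by
      simp only [star_sub, star_mul, hπp.isSelfAdjoint.star_eq]
      noncomm_ring
    rw [this, hv]
    simp [hπp.isIdempotentElem.eq]
  have hqv : π q * v = v := by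
    calc π q * v = π q * (v * star v) * v := by rw [mul_assoc, mul_assoc, hv, hvp]
      _ = v := by rw [hve, hqe, ← hve, mul_assoc, hv, hvp]
  obtain ⟨w₀, hw₀⟩ := hsurj v
  obtain ⟨w, hw⟩ : ∃ w, w = q * w₀ * p := ⟨_, rfl⟩
  have hπw : π w = v := by rw [hw, map_mul, map_mul, hw₀, hqv, hvp]
  have hqw : q * w = w := by rw [hw, ← mul_assoc, ← mul_assoc, hq₂]
  have hwp : w * p = w := by rw [hw, mul_assoc, hp₂]
  have hpw : p * star w = star w := by simpa [hp₁] using congr(star $hwp)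
  obtain ⟨f, ⟨z, hz, hfz⟩, hfs, hff, hnorm, -⟩ := hAI (star w * w - p)
    ⟨star w * w - p, by rw [map_sub, map_mul, map_star, hπw, hv, sub_self], by
      rw [mul_sub, sub_mul, ← mul_assoc p, hpw, hp₂, hp₂, mul_assoc, hwp]⟩ 1 one_pos
  have hpf : p * f = f := by rw [hfz, ← mul_assoc, ← mul_assoc, hp₂]
  have hfp : f * p = f := by rw [hfz, mul_assoc, hp₂]
  have hπf : π f = 0 := by simp [hfz, hz]
  obtain ⟨r, hr⟩ : ∃ r, r = p - f := ⟨_, rfl⟩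
  have hpr : p * r = r := by rw [hr, mul_sub, hp₂, hpf]
  have hrp : r * p = r := by rw [hr, sub_mul, hp₂, hfp]
  have hrr : r * r = r := by
    nth_rw 1 [hr]
    rw [sub_mul, hpr, hr, mul_sub, hfp, hff, sub_self, sub_zero]
  have hrs : star r = r := by rw [hr, star_sub, hp₁, hfs]
  have hrproj : IsStarProjection r := ⟨hrr, hrs⟩
  have hπr : π r = π p := by rw [hr, map_sub, hπf, sub_zero]
  have hcut : star (w * r) * (w * r) - r
      = ((star w * w - p) - f * (star w * w - p)) * r := by
    have hrw : r * star w = star w - f * star w := by rw [hr, sub_mul, hpw]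
    calc star (w * r) * (w * r) - r = r * star w * w * r - r := by
          simp only [star_mul, hrs, mul_assoc]
      _ = _ := by
          rw [hrw, sub_mul _ _ r, sub_mul _ p r, hpr, mul_sub f, hfp, sub_mul _ f r, hr]
          simp only [mul_sub, sub_mul, hfp, hff, ← mul_assoc]
          abel
  have hlt : ‖star (w * r) * (w * r) - r‖ < 1 := by
    rw [hcut]
    exact (norm_mul_le _ _).trans_lt
      ((mul_le_of_le_one_right (norm_nonneg _) hrproj.norm_le).trans_lt hnorm)
  obtain ⟨y, hy, hyr, hπy⟩ :=
    exists_star_mul_self_eq_of_norm_sub_lt_one π hrproj (by rw [mul_assoc, hrr]) hlt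
  have hπwr : π (w * r) = v := by rw [map_mul, hπw, hπr, hvp]
  have hπu : π (w * r + w * r * y) = v := by
    rw [map_add, map_mul π (w * r) y, hπwr, hπy (by rw [map_mul, map_star, hπwr, hv, hπr]),
      mul_zero, add_zero]
  have hqu : q * (w * r + w * r * y) = w * r + w * r * y := by
    simp only [mul_add, ← mul_assoc, hqw]
  generalize w * r + w * r * y = u at hy hyr hπu hqu
  have hπe : π (u * star u) = e := by rw [map_mul, map_star, hπu, hve]
  refine ⟨r, u * star u, hrs, hrr, by simp, ?_, hpr, by rw [← mul_assoc, hqu],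
    ⟨u, hy, rfl⟩, hπr, by rw [hπe, hqe], by rwa [hπe]⟩
  rw [← mul_assoc, mul_assoc u, hy, hyr]
end

section
/- Let A be a C*-algebra, let I be a closed two-sided ideal of A, and let a ∈ A be a positive element. Suppose that σ(a) is norm-full in the multiplier algebra M(I), i.e., the smallest closed two-sided ideal of M(I) containing σ(a) is M(I) itself. Then I is contained in the smallest closed two-sided ideal of A containing a. -/
open MultiplierAlgebra

/-- An element of a C*-algebra is positive if it is of the form `x* x`. -/
def IsPositiveElem {A : Type*} [NonUnitalCStarAlgebra A] (a : A) : Prop :=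
  ∃ x : A, a = star x * x

/-- The smallest closed two-sided ideal of `C` containing a given subset `s`, realized as
the intersection of all closed two-sided ideals containing `s`. -/
def closedIdealGeneratedBy {C : Type*} [NonUnitalNonAssocRing C] [TopologicalSpace C]
    (s : Set C) : Set C :=
  ⋂ J ∈ {J : TwoSidedIdeal C | IsClosed (J : Set C) ∧ s ⊆ (J : Set C)}, (J : Set C)

/-- The canonical homomorphism `σ : A → M(I)` for a closed two-sided ideal `I` of a
C*-algebra `A`, sending `a : A` to the multiplier `(x ↦ a x, x ↦ x a)` of `I`. -/
noncomputable def idealMultiplier {A : Type*} [NonUnitalCStarAlgebra A]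
    (S : NonUnitalStarSubalgebra ℂ A) [IsClosed (S : Set A)]
    (hS : ∀ a : A, ∀ x ∈ S, a * x ∈ S ∧ x * a ∈ S) (a : A) : 𝓜(ℂ, S) where
  fst := LinearMap.mkContinuous
    { toFun := fun x : S => (⟨a * (x : A), (hS a x x.2).1⟩ : S)
      map_add' := fun x y => Subtype.ext (by simp [mul_add])
      map_smul' := fun c x => Subtype.ext (by simp [mul_smul_comm]) } ‖a‖
    (fun x => by simpa using norm_mul_le a (x : A))
  snd := LinearMap.mkContinuous
    { toFun := fun x : S => (⟨(x : A) * a, (hS a x x.2).2⟩ : S)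
      map_add' := fun x y => Subtype.ext (by simp [add_mul])
      map_smul' := fun c x => Subtype.ext (by simp [smul_mul_assoc]) } ‖a‖
    (fun x => by simpa [mul_comm] using norm_mul_le (x : A) a)
  central := fun x y => Subtype.ext (by simpa using mul_assoc (x : A) a (y : A))

/-- Every closed set that contains all products of a C*-algebra contains the algebra. -/
lemma mem_of_isClosed_of_forall_mul_mem {B : Type*} [NonUnitalCStarAlgebra B] {s : Set B}
    (hs : IsClosed s) (hmul : ∀ x y : B, x * y ∈ s) (x : B) : x ∈ s := by
  let _ := CStarAlgebra.spectralOrder B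
  have := CStarAlgebra.spectralOrderedRing B
  exact hs.mem_of_tendsto ((CStarAlgebra.increasingApproximateUnit B).tendsto_mul_left x)
    (.of_forall fun e ↦ hmul x e)

lemma DoubleCentralizer.continuous_fst_apply {B : Type*} [NonUnitalCStarAlgebra B] (y : B) :
    Continuous fun m : 𝓜(ℂ, B) ↦ m.fst y :=
  (isUniformEmbedding_toProdMulOpposite (𝕜 := ℂ) (A := B)).uniformContinuous.continuous.fst.clm_apply
    continuous_const

/-- The multipliers `m` of `B` such that `x * (m y)` lies in the two-sided ideal `J` for all
`x y : B`. -/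
noncomputable def multiplierIdeal {B : Type*} [NonUnitalCStarAlgebra B] (J : TwoSidedIdeal B) :
    TwoSidedIdeal 𝓜(ℂ, B) :=
  .mk' {m | ∀ x y : B, x * m.fst y ∈ J}
    (fun x y ↦ by simp [J.zero_mem])
    (fun hm hn x y ↦ by simpa [mul_add] using J.add_mem (hm x y) (hn x y))
    (fun hm x y ↦ by simpa using J.neg_mem (hm x y))
    (fun {m n} hn x y ↦ by
      rw [DoubleCentralizer.mul_fst, mul_apply_eq_comp, ← m.central]
      exact hn _ y)
    (fun {m n} hm x y ↦ hm x (n.fst y))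

lemma mem_multiplierIdeal {B : Type*} [NonUnitalCStarAlgebra B] {J : TwoSidedIdeal B}
    {m : 𝓜(ℂ, B)} : m ∈ multiplierIdeal J ↔ ∀ x y : B, x * m.fst y ∈ J :=
  TwoSidedIdeal.mem_mk' ..

lemma isClosed_multiplierIdeal {B : Type*} [NonUnitalCStarAlgebra B] {J : TwoSidedIdeal B}
    (hJ : IsClosed (J : Set B)) : IsClosed (multiplierIdeal J : Set 𝓜(ℂ, B)) := by
  have h : (multiplierIdeal J : Set 𝓜(ℂ, B)) =
      ⋂ (x : B) (y : B), (fun m : 𝓜(ℂ, B) ↦ x * m.fst y) ⁻¹' (J : Set B) := by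
    ext m
    simp [mem_multiplierIdeal]
  rw [h]
  exact isClosed_iInter fun x ↦ isClosed_iInter fun y ↦
    hJ.preimage (continuous_const.mul (DoubleCentralizer.continuous_fst_apply y))

/-- Let `A` be a C*-algebra, `I` a closed two-sided ideal of `A`, and `a ∈ A`
a positive element.  If `σ(a)` is norm-full in the multiplier algebra `M(I)` (the smallest
closed two-sided ideal of `M(I)` containing `σ(a)` is all of `M(I)`), then `I` is contained
in the smallest closed two-sided ideal of `A` containing `a`. -/
theorem ideal_le_closedIdeal_of_multiplier_full
    {A : Type*} [NonUnitalCStarAlgebra A]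
    (S : NonUnitalStarSubalgebra ℂ A) [IsClosed (S : Set A)]
    (hS : ∀ a : A, ∀ x ∈ S, a * x ∈ S ∧ x * a ∈ S)
    (a : A) (ha : IsPositiveElem a)
    (hfull : closedIdealGeneratedBy {idealMultiplier S hS a} = Set.univ) :
    (S : Set A) ⊆ closedIdealGeneratedBy {a} := by
  refine fun z hz ↦ Set.mem_iInter₂.2 fun J ⟨hJ, haJ⟩ ↦ ?_
  let K : TwoSidedIdeal S := J.comap (NonUnitalSubalgebraClass.subtype S)
  have hK : (K : Set S) = Subtype.val ⁻¹' (J : Set A) := by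
    ext x
    exact TwoSidedIdeal.mem_comap _
  have hKc : IsClosed (K : Set S) := hK ▸ hJ.preimage continuous_subtype_val
  have hσ : idealMultiplier S hS a ∈ multiplierIdeal K :=
    mem_multiplierIdeal.2 fun x y ↦ (TwoSidedIdeal.mem_comap _).2 <|
      J.mul_mem_left _ _ (J.mul_mem_right _ _ (haJ rfl))
  have hone : (1 : 𝓜(ℂ, S)) ∈ multiplierIdeal K :=
    Set.mem_iInter₂.1 (hfull ▸ Set.mem_univ (1 : 𝓜(ℂ, S))) (multiplierIdeal K)
      ⟨isClosed_multiplierIdeal hKc, Set.singleton_subset_iff.2 hσ⟩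
  have hzK : (⟨z, hz⟩ : S) ∈ (K : Set S) :=
    mem_of_isClosed_of_forall_mul_mem hKc (mem_multiplierIdeal.1 hone) _
  exact (TwoSidedIdeal.mem_comap _).1 hzK
end

section
/- Let π : A → B be a surjective *-homomorphism between C*-algebras and let I = ker π. Suppose the extension 0 → I → A → B → 0 is stenotic, i.e., every closed two-sided ideal T of A satisfies T ⊆ I or I ⊆ T. Then for all elements p, q ∈ A with p ∉ I and q ∉ I: p and q generate the same closed two-sided ideal of A if and only if π(p) and π(q) generate the same closed two-sided ideal of B. -/
/-- The smallest closed two-sided ideal of `C` containing a given element `x`, realized as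
the intersection of all closed two-sided ideals containing `x`. -/
def closedIdealGenerated {C : Type*} [NonUnitalNonAssocRing C] [TopologicalSpace C]
    (x : C) : Set C :=
  ⋂ J ∈ {J : TwoSidedIdeal C | IsClosed (J : Set C) ∧ x ∈ J}, (J : Set C)

section

variable {C D : Type*} [NonUnitalNonAssocRing C] [TopologicalSpace C]
  [NonUnitalNonAssocRing D] [TopologicalSpace D]

theorem mem_closedIdealGenerated_iff {x y : C} :
    y ∈ closedIdealGenerated x ↔
      ∀ J : TwoSidedIdeal C, IsClosed (J : Set C) → x ∈ J → y ∈ J := by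
  simp [closedIdealGenerated]

theorem closedIdealGenerated_eq_iff {x y : C} :
    closedIdealGenerated x = closedIdealGenerated y ↔
      ∀ J : TwoSidedIdeal C, IsClosed (J : Set C) → (x ∈ J ↔ y ∈ J) := by
  constructor
  · intro h J hJ
    have hx : x ∈ closedIdealGenerated y :=
      h ▸ mem_closedIdealGenerated_iff.2 fun _ _ hx ↦ hx
    have hy : y ∈ closedIdealGenerated x :=
      h ▸ mem_closedIdealGenerated_iff.2 fun _ _ hy ↦ hy
    exact ⟨mem_closedIdealGenerated_iff.1 hy J hJ, mem_closedIdealGenerated_iff.1 hx J hJ⟩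
  · intro h
    ext z
    simp only [mem_closedIdealGenerated_iff]
    exact forall₂_congr fun J hJ ↦ by rw [h J hJ]

/-- A closed two-sided ideal containing the kernel of a quotient map is the preimage of a closed
two-sided ideal. -/
theorem exists_isClosed_twoSidedIdeal_comap_eq {F : Type*} [FunLike F C D]
    [NonUnitalRingHomClass F C D] (f : F) (hf : Topology.IsQuotientMap f)
    (T : TwoSidedIdeal C) (hT : IsClosed (T : Set C)) (hker : {x : C | f x = 0} ⊆ (T : Set C)) :
    ∃ J : TwoSidedIdeal D, IsClosed (J : Set D) ∧ ∀ x, f x ∈ J ↔ x ∈ T := by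
  have key : ∀ x, f x ∈ f '' (T : Set C) ↔ x ∈ T := by
    refine fun x ↦ ⟨?_, fun hx ↦ ⟨x, hx, rfl⟩⟩
    rintro ⟨t, ht, htx⟩
    have hmem : x - t ∈ T := hker (by simp [htx])
    simpa using T.add_mem hmem ht
  let J : TwoSidedIdeal D := TwoSidedIdeal.mk' (f '' (T : Set C))
    ⟨0, T.zero_mem, map_zero f⟩
    (by
      rintro _ _ ⟨a, ha, rfl⟩ ⟨b, hb, rfl⟩
      exact ⟨a + b, T.add_mem ha hb, map_add f a b⟩)
    (by
      rintro _ ⟨a, ha, rfl⟩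
      exact ⟨-a, T.neg_mem ha, map_neg f a⟩)
    (by
      rintro d _ ⟨a, ha, rfl⟩
      obtain ⟨c, rfl⟩ := hf.surjective d
      exact ⟨c * a, T.mul_mem_left c a ha, map_mul f c a⟩)
    (by
      rintro _ d ⟨a, ha, rfl⟩
      obtain ⟨c, rfl⟩ := hf.surjective d
      exact ⟨a * c, T.mul_mem_right a c ha, map_mul f a c⟩)
  have hJ : (J : Set D) = f '' (T : Set C) := TwoSidedIdeal.coe_mk' ..
  refine ⟨J, ?_, fun x ↦ ?_⟩
  · rw [hJ, ← hf.isClosed_preimage]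
    convert hT using 1
    ext x
    exact key x
  · rw [← SetLike.mem_coe, hJ]
    exact key x

end

/-- Let `π : A → B` be a surjective *-homomorphism between C*-algebras with
kernel `I`, and suppose the extension `0 → I → A → B → 0` is stenotic (every closed
two-sided ideal `T` of `A` satisfies `T ⊆ I` or `I ⊆ T`).  Then for all `p, q ∈ A` with
`p ∉ I` and `q ∉ I` : `p` and `q` generate the same closed two-sided ideal of `A` if and
only if `π p` and `π q` generate the same closed two-sided ideal of `B`. -/
theorem same_closedIdeal_iff_same_closedIdeal_in_quotient
    {A B : Type*} [NonUnitalCStarAlgebra A] [NonUnitalCStarAlgebra B]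
    (π : A →⋆ₙₐ[ℂ] B) (hsurj : Function.Surjective π)
    (hsten : ∀ T : TwoSidedIdeal A, IsClosed (T : Set A) →
      (T : Set A) ⊆ {x : A | π x = 0} ∨ {x : A | π x = 0} ⊆ (T : Set A))
    (p q : A) (hp : π p ≠ 0) (hq : π q ≠ 0) :
    closedIdealGenerated p = closedIdealGenerated q ↔
      closedIdealGenerated (π p) = closedIdealGenerated (π q) := by
  have hcont : Continuous π :=
    AddMonoidHomClass.continuous_of_bound π 1 fun a ↦ by
      simpa using NonUnitalStarAlgHom.norm_apply_le π a
  let πL : A →L[ℂ] B := ⟨(π : A →ₗ[ℂ] B), hcont⟩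
  have hquot : Topology.IsQuotientMap π := πL.isQuotientMap hsurj
  rw [closedIdealGenerated_eq_iff, closedIdealGenerated_eq_iff]
  constructor
  · intro h J hJ
    have hcomap := h (J.comap π) (by
      convert hJ.preimage hcont using 1
      ext x
      exact TwoSidedIdeal.mem_comap π)
    rwa [TwoSidedIdeal.mem_comap, TwoSidedIdeal.mem_comap] at hcomap
  · intro h T hT
    rcases hsten T hT with hle | hge
    · exact ⟨fun hpT ↦ absurd (hle hpT) hp, fun hqT ↦ absurd (hle hqT) hq⟩
    · obtain ⟨J, hJ, hmem⟩ := exists_isClosed_twoSidedIdeal_comap_eq π hquot T hT hge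
      rw [← hmem p, ← hmem q]
      exact h J hJ
end

section
/- Let A be a C*-algebra and let a ∈ A be a positive element which is norm-full in A. Then for every closed two-sided ideal I of A, the closure of the set aIa = {axa : x ∈ I} is norm-full in the C*-algebra I; that is, the smallest closed two-sided ideal of I containing {axa : x ∈ I} is I itself. -/
/-- In a C*-algebra, every `x` is a norm limit of elements of the form `x * c * (star x * x)`. -/
theorem exists_norm_sub_mul_mul_star_mul_self_le {A : Type*} [NonUnitalCStarAlgebra A]
    (x : A) {ε : ℝ} (hε : 0 < ε) : ∃ c : A, ‖x - x * c * (star x * x)‖ ≤ ε := by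
  set b : A := star x * x with hb
  have hbs : IsSelfAdjoint b := IsSelfAdjoint.star_mul_self x
  obtain ⟨r, hr, hrε⟩ : ∃ r : ℝ, 0 < r ∧ 1 / r = ε ^ 2 :=
    ⟨1 / ε ^ 2, by positivity, by field_simp⟩
  have hpos : ∀ t : ℝ, 0 < 1 + r ^ 2 * t ^ 2 := fun t => by positivity
  let h : ℝ → ℝ := fun t => r ^ 2 * t / (1 + r ^ 2 * t ^ 2)
  have hc : Continuous h :=
    Continuous.div (by fun_prop) (by fun_prop) fun t => (hpos t).ne'
  have h0 : h 0 = 0 := by simp [h]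
  let c : A := cfcₙ h b
  have hcs : star c = c := (cfcₙ_predicate h b : IsSelfAdjoint c)
  refine ⟨c, ?_⟩
  have hid : cfcₙ (fun t : ℝ => t) b = b := cfcₙ_id' ℝ b
  have hbcb : cfcₙ (fun t : ℝ => t * h t * t) b = b * c * b := by
    rw [cfcₙ_mul (fun t : ℝ => t * h t) (fun t => t) b (by fun_prop) (by simp) (by fun_prop) rfl,
      cfcₙ_mul (fun t : ℝ => t) h b (by fun_prop) rfl (by fun_prop) h0, hid]
  have hbcbcb : cfcₙ (fun t : ℝ => t * h t * t * (h t * t)) b = b * c * b * (c * b) := by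
    rw [cfcₙ_mul (fun t : ℝ => t * h t * t) (fun t => h t * t) b (by fun_prop) (by simp)
        (by fun_prop) (by simp), hbcb,
      cfcₙ_mul h (fun t : ℝ => t) b (by fun_prop) h0 (by fun_prop) rfl, hid]
  have hsq : star (x - x * c * b) * (x - x * c * b) =
      cfcₙ (fun t : ℝ => t - t * h t * t - (t * h t * t - t * h t * t * (h t * t))) b := by
    rw [cfcₙ_sub (fun t : ℝ => t - t * h t * t)
        (fun t => t * h t * t - t * h t * t * (h t * t)) b (by fun_prop) (by simp)
        (by fun_prop) (by simp),
      cfcₙ_sub (fun t : ℝ => t) (fun t => t * h t * t) b (by fun_prop) rfl (by fun_prop) (by simp),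
      cfcₙ_sub (fun t : ℝ => t * h t * t) (fun t => t * h t * t * (h t * t)) b (by fun_prop)
        (by simp) (by fun_prop) (by simp), hbcbcb, hbcb, hid]
    rw [star_sub, star_mul (x * c) b, star_mul x c, hcs, hbs.star_eq]
    simp only [sub_mul, mul_sub, mul_assoc]
    simp only [← mul_assoc (star x) x, ← hb]
  have hle : ‖star (x - x * c * b) * (x - x * c * b)‖ ≤ ε ^ 2 := by
    rw [hsq]
    refine norm_cfcₙ_le fun t _ => ?_
    have hq := hpos t
    have e : t - t * h t * t - (t * h t * t - t * h t * t * (h t * t)) =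
        t / (1 + r ^ 2 * t ^ 2) ^ 2 := by
      simp only [h]
      field_simp
      ring
    rw [e, ← hrε, Real.norm_eq_abs, abs_div, abs_of_pos (pow_pos hq 2),
      div_le_div_iff₀ (pow_pos hq 2) hr, one_mul]
    have hs : |t| ^ 2 = t ^ 2 := sq_abs t
    have h1 : |t| * r ≤ 1 + r ^ 2 * t ^ 2 := by nlinarith [sq_nonneg (|t| * r - 1)]
    nlinarith [mul_nonneg (sq_nonneg r) (sq_nonneg t)]
  rw [CStarRing.norm_star_mul_self, ← sq] at hle
  exact (sq_le_sq₀ (norm_nonneg _) hε.le).mp hle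

/-- A closed set containing every `x * c * (star x * x)` contains `x`. -/
theorem IsClosed.mem_of_forall_mul_mul_star_mul_self_mem {A : Type*} [NonUnitalCStarAlgebra A]
    {J : Set A} (hJ : IsClosed J) {x : A} (hx : ∀ c : A, x * c * (star x * x) ∈ J) : x ∈ J := by
  rw [← hJ.closure_eq, Metric.mem_closure_iff]
  intro ε hε
  obtain ⟨c, hc⟩ := exists_norm_sub_mul_mul_star_mul_self_le x (half_pos hε)
  exact ⟨_, hx c, by rw [dist_eq_norm]; linarith⟩


/-- Let `A` be a C*-algebra and `a ∈ A` a positive element which is norm-full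
in `A` (the smallest closed two-sided ideal of `A` containing `a` is `A` itself).  Then
for every closed two-sided ideal `I` of `A`, the set `{a x a : x ∈ I}` is norm-full in the
C*-algebra `I` : every closed two-sided ideal `J` of `I` containing `{a x a : x ∈ I}` is
all of `I`. -/
theorem corner_full_in_ideal_of_full
    {A : Type*} [NonUnitalCStarAlgebra A]
    (a : A) (ha : IsPositiveElem a)
    (hfull : closedIdealGenerated a = Set.univ)
    (I : TwoSidedIdeal A) (hIclosed : IsClosed (I : Set A)) :
    ∀ J : Set A, J ⊆ (I : Set A) → IsClosed J →
      (0 : A) ∈ J → (∀ x ∈ J, ∀ y ∈ J, x + y ∈ J) → (∀ x ∈ J, -x ∈ J) →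
      (∀ x ∈ I, ∀ j ∈ J, x * j ∈ J ∧ j * x ∈ J) →
      (∀ x ∈ I, a * x * a ∈ J) →
      ∀ y ∈ I, y ∈ J := by
  intro J hJI hJ h0 hadd hneg hmul haJ
  have hsa : star a = a := by
    obtain ⟨z, rfl⟩ := ha
    simp
  have hxa : ∀ x ∈ I, x * a ∈ J := by
    refine fun x hx => hJ.mem_of_forall_mul_mul_star_mul_self_mem fun c => ?_
    refine (hmul _ (I.mul_mem_right _ _ (I.mul_mem_right _ _ hx)) _ ?_).1
    have := haJ (star x * x) (I.mul_mem_left _ _ hx)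
    simpa only [star_mul, hsa, mul_assoc] using this
  let K : TwoSidedIdeal A := TwoSidedIdeal.mk' {b | ∀ x ∈ I, ∀ y ∈ I, x * b * y ∈ J}
    (fun x _ y _ => by simpa using h0)
    (fun hb hc x hx y hy => by
      rw [mul_add, add_mul]
      exact hadd _ (hb x hx y hy) _ (hc x hx y hy))
    (fun hb x hx y hy => by
      rw [mul_neg, neg_mul]
      exact hneg _ (hb x hx y hy))
    (fun {c b} hb x hx y hy => by
      rw [← mul_assoc x c b]
      exact hb _ (I.mul_mem_right _ _ hx) y hy)
    (fun {b c} hb x hx y hy => by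
      rw [← mul_assoc x b c, mul_assoc (x * b)]
      exact hb x hx _ (I.mul_mem_left _ _ hy))
  have hK : (K : Set A) = {b | ∀ x ∈ I, ∀ y ∈ I, x * b * y ∈ J} := TwoSidedIdeal.coe_mk' ..
  have hKclosed : IsClosed (K : Set A) := by
    rw [hK]
    simp only [Set.ofPred_forall]
    exact isClosed_iInter fun x => isClosed_iInter fun _ => isClosed_iInter fun y =>
      isClosed_iInter fun _ => hJ.preimage (by fun_prop)
  have haK : a ∈ K := by
    rw [← SetLike.mem_coe, hK]
    exact fun x hx y hy => (hmul y hy _ (hxa x hx)).2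
  have hKtop : ∀ c, ∀ x ∈ I, ∀ y ∈ I, x * c * y ∈ J := by
    intro c
    have hc : c ∈ closedIdealGenerated a := hfull ▸ Set.mem_univ c
    have hcK : c ∈ (K : Set A) := Set.mem_iInter₂.mp hc K ⟨hKclosed, haK⟩
    rwa [hK] at hcK
  exact fun y hy => hJ.mem_of_forall_mul_mul_star_mul_self_mem fun c =>
    hKtop c y hy _ (I.mul_mem_left _ _ hy)
end

section
/- Let A be a C*-algebra with real rank zero and let I be a closed two-sided ideal of A. Suppose that for every projection p ∈ A with p ∉ I, the smallest closed two-sided ideal of the multiplier algebra M(I) containing σ(p) together with θ(I) is M(I) itself (this says that the image of p under the Busby invariant is norm-full in the corona algebra M(I)/I). Then for every a ∈ A with a ∉ I, the smallest closed two-sided ideal of M(I) containing σ(a) together with θ(I) is M(I) itself (i.e., the extension 0 → I → A → A/I → 0 is full). -/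
open MultiplierAlgebra

/-- A C*-algebra `A` has real rank zero if, in the unitization of `A`, the invertible
self-adjoint elements are dense in the set of self-adjoint elements. -/
def HasRealRankZero (A : Type*) [NonUnitalCStarAlgebra A] : Prop :=
  ∀ x : Unitization ℂ A, IsSelfAdjoint x →
    x ∈ closure {y : Unitization ℂ A | IsSelfAdjoint y ∧ IsUnit y}

/-- The spectral projection of a self-adjoint invertible element for the positive half-line,
together with a left factor `g` of norm at most `t⁻¹` recovering it from `y + t`. -/
lemma exists_positive_spectral_projection {B : Type*} [CStarAlgebra B] [PartialOrder B]
    [StarOrderedRing B] {y : B} (hy : IsSelfAdjoint y) (hu : IsUnit y) {t : ℝ} (ht : 0 < t) :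
    ∃ q g : B, IsSelfAdjoint q ∧ q * q = q ∧ g * (y + algebraMap ℝ B t) = q ∧ ‖g‖ ≤ t⁻¹ ∧
      (1 - q) * y * (1 - q) ≤ 0 := by
  have h0 : ∀ s ∈ spectrum ℝ y, s ≠ 0 := by
    rintro s hs rfl
    exact spectrum.zero_notMem ℝ hu hs
  have hχ : ContinuousOn (fun s : ℝ => if 0 < s then (1 : ℝ) else 0) (spectrum ℝ y) := by
    intro s hs
    apply ContinuousAt.continuousWithinAt
    rcases lt_or_gt_of_ne (h0 s hs) with h | h
    · exact (continuousAt_const (y := (0 : ℝ))).congr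
        ((gt_mem_nhds h).mono fun r (hr : r < 0) => by simp [hr.not_gt])
    · exact (continuousAt_const (y := (1 : ℝ))).congr
        ((lt_mem_nhds h).mono fun r (hr : 0 < r) => by simp [hr])
  have hg : ContinuousOn (fun s : ℝ => (if 0 < s then (1 : ℝ) else 0) * (|s| + t)⁻¹)
      (spectrum ℝ y) :=
    hχ.mul (Continuous.continuousOn (Continuous.inv₀ (by fun_prop) fun s => by positivity))
  refine ⟨cfc (fun s : ℝ => if 0 < s then (1 : ℝ) else 0) y,
    cfc (fun s : ℝ => (if 0 < s then (1 : ℝ) else 0) * (|s| + t)⁻¹) y,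
    cfc_predicate _ _, ?_, ?_, ?_, ?_⟩
  · rw [← cfc_mul _ _ y hχ hχ]
    exact cfc_congr fun s _ => by simp
  · have h1 : y + algebraMap ℝ B t = cfc (fun s : ℝ => s + t) y := by
      rw [cfc_add_const t (fun s : ℝ => s) y, cfc_id' ℝ y]
    rw [h1, ← cfc_mul _ _ y hg (by fun_prop)]
    refine cfc_congr fun s _ => ?_
    rcases le_or_gt s 0 with h | h
    · simp [h.not_gt]
    · have : s + t ≠ 0 := by positivity
      simp [h, abs_of_pos h, this]
  · refine norm_cfc_le (by positivity) fun s _ => ?_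
    rcases le_or_gt s 0 with h | h
    · simp [h.not_gt, ht.le]
    · have : 0 < s + t := by positivity
      simp only [h, if_true, one_mul, abs_of_pos h, Real.norm_eq_abs, abs_inv, abs_of_pos this]
      exact inv_anti₀ ht (by linarith)
  · have h1 : 1 - cfc (fun s : ℝ => if 0 < s then (1 : ℝ) else 0) y
        = cfc (fun s : ℝ => 1 - if 0 < s then (1 : ℝ) else 0) y := by
      rw [cfc_sub _ _ y (by fun_prop) hχ, cfc_const_one ℝ y]
    have h2 : ContinuousOn (fun s : ℝ => 1 - if 0 < s then (1 : ℝ) else 0) (spectrum ℝ y) :=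
      continuousOn_const.sub hχ
    rw [h1]
    nth_rewrite 2 [← cfc_id' ℝ y]
    rw [← cfc_mul _ _ y h2 (continuousOn_id' _),
      ← cfc_mul (fun s => _ * s) _ y (h2.mul (continuousOn_id' _)) h2]
    refine cfc_nonpos _ y fun s _ => ?_
    rcases le_or_gt s 0 with h | h
    · simpa [h.not_gt] using h
    · simp [h]

/-- In a C*-algebra of real rank zero, every element `a` can be approximately cut down by a
projection lying in the algebraic ideal generated by `a`. -/
lemma HasRealRankZero.exists_projection {A : Type*} [NonUnitalCStarAlgebra A]
    (hRR : HasRealRankZero A) (a : A) {δ : ℝ} (hδ : 0 < δ) :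
    ∃ (p x y : A) (c : ℂ), star p = p ∧ p * p = p ∧ p = c • (x * a) + x * a * y ∧
      ‖a - a * p‖ < δ := by
  let : PartialOrder (Unitization ℂ A) := CStarAlgebra.spectralOrder _
  have : StarOrderedRing (Unitization ℂ A) := CStarAlgebra.spectralOrderedRing _
  set b : Unitization ℂ A := (a : Unitization ℂ A) with hb
  set t : ℝ := δ ^ 2 / 2 with ht
  have htpos : 0 < t := by positivity
  have hbb : IsSelfAdjoint (star b * b) := IsSelfAdjoint.star_mul_self b
  have hsa : IsSelfAdjoint (star b * b - algebraMap ℝ (Unitization ℂ A) t) :=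
    hbb.sub (IsSelfAdjoint.algebraMap _ (IsSelfAdjoint.all t))
  obtain ⟨y, ⟨hy, hyu⟩, hdist⟩ := Metric.mem_closure_iff.1 (hRR _ hsa) (t / 2) (by positivity)
  obtain ⟨q, g, hq, hqq, hgq, hgn, hneg⟩ := exists_positive_spectral_projection hy hyu htpos
  set d := star b * b - (y + algebraMap ℝ (Unitization ℂ A) t) with hd
  have hdn : ‖d‖ < t / 2 := by
    rw [dist_eq_norm] at hdist
    rwa [hd, add_comm, ← sub_sub]
  have hqn : ‖q‖ ≤ 1 := by
    have h := CStarRing.norm_star_mul_self (x := q)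
    rw [hq.star_eq, hqq] at h
    nlinarith [norm_nonneg q]
  have hlt : ‖q * -(g * d)‖ < 1 := calc
    ‖q * -(g * d)‖ ≤ ‖q‖ * (‖g‖ * ‖d‖) := by
      refine (norm_mul_le _ _).trans ?_
      rw [norm_neg]
      gcongr
      exact norm_mul_le _ _
    _ ≤ 1 * (t⁻¹ * (t / 2)) := by gcongr
    _ < 1 := by
      have : t⁻¹ * t = 1 := inv_mul_cancel₀ htpos.ne'
      linarith
  obtain ⟨u, hu⟩ := isUnit_one_sub_of_norm_lt_one hlt
  have hgd : g * d = g * (star b * b) - q := by rw [hd, mul_sub, hgq]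
  have hqu : q * u = q * g * star b * b := by
    rw [hu, hgd]
    simp only [mul_sub, mul_neg, mul_one, ← mul_assoc, hqq]
    abel
  have hq' : q = q * g * star b * b * (↑u⁻¹ : Unitization ℂ A) := by
    rw [← hqu, mul_assoc, Units.mul_inv, mul_one]
  obtain ⟨x, hx⟩ : ∃ x : A, q * g * star b = x := by
    refine ⟨(q * g * star b).snd, Unitization.ext ?_ ?_⟩ <;> simp [hb]
  set v : Unitization ℂ A := (↑u⁻¹ : Unitization ℂ A) with hv
  set p : A := v.fst • (x * a) + x * a * v.snd with hp
  have hqp : q = (p : Unitization ℂ A) := by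
    rw [hq', hx, hb, hp]
    ext <;> simp
  refine ⟨p, x, v.snd, v.fst, ?_, ?_, hp, ?_⟩
  · apply Unitization.inr_injective (R := ℂ)
    rw [Unitization.inr_star, ← hqp, hq.star_eq]
  · apply Unitization.inr_injective (R := ℂ)
    rw [Unitization.inr_mul, ← hqp, hqq]
  · have h1 : ‖a - a * p‖ = ‖b * (1 - q)‖ := by
      rw [hqp, ← Unitization.norm_inr (𝕜 := ℂ), mul_sub, mul_one, hb, ← Unitization.inr_mul,
        ← Unitization.inr_sub]
    have hsq : IsSelfAdjoint (1 - q) := (IsSelfAdjoint.one _).sub hq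
    have hdsa : IsSelfAdjoint d :=
      hbb.sub (hy.add (IsSelfAdjoint.algebraMap _ (IsSelfAdjoint.all t)))
    have hle : star (b * (1 - q)) * (b * (1 - q))
        ≤ algebraMap ℝ (Unitization ℂ A) (t + t / 2) := by
      have hdle : d ≤ algebraMap ℝ (Unitization ℂ A) (t / 2) :=
        hdsa.le_algebraMap_norm_self.trans (algebraMap_mono _ hdn.le)
      have hbd : star b * b = y + (algebraMap ℝ (Unitization ℂ A) t + d) := by
        rw [hd]
        abel
      have hconj : (1 - q) * (algebraMap ℝ (Unitization ℂ A) t + d) * (1 - q)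
          ≤ (1 - q) * algebraMap ℝ (Unitization ℂ A) (t + t / 2) * (1 - q) := by
        refine hsq.conjugate_le_conjugate ?_
        rw [map_add]
        gcongr
      have hcut : (1 - q) * algebraMap ℝ (Unitization ℂ A) (t + t / 2) * (1 - q)
          ≤ algebraMap ℝ (Unitization ℂ A) (t + t / 2) := by
        have hqq' : (1 - q) * (1 - q) = 1 - q := by
          simp only [mul_sub, sub_mul, one_mul, mul_one, hqq]
          abel
        have hq0 : 0 ≤ q := by
          simpa [hq.star_eq, hqq] using star_mul_self_nonneg q
        rw [← Algebra.commutes, mul_assoc, hqq', ← Algebra.smul_def,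
          Algebra.algebraMap_eq_smul_one]
        exact smul_le_smul_of_nonneg_left (sub_le_self _ hq0) (by positivity)
      calc star (b * (1 - q)) * (b * (1 - q))
          = (1 - q) * y * (1 - q) + (1 - q) * (algebraMap ℝ (Unitization ℂ A) t + d) * (1 - q) := by
            rw [star_mul, hsq.star_eq, ← add_mul, ← mul_add, ← hbd]
            simp only [mul_assoc]
        _ ≤ 0 + algebraMap ℝ (Unitization ℂ A) (t + t / 2) :=
            add_le_add hneg (hconj.trans hcut)
        _ = _ := zero_add _
    have h2 : ‖b * (1 - q)‖ * ‖b * (1 - q)‖ ≤ t + t / 2 := by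
      rw [← CStarRing.norm_star_mul_self]
      refine (CStarAlgebra.norm_le_norm_of_nonneg_of_le (star_mul_self_nonneg _) hle).trans ?_
      rw [norm_algebraMap', Real.norm_of_nonneg (by positivity)]
    rw [h1]
    nlinarith [norm_nonneg (b * (1 - q))]

/-- Let `A` be a C*-algebra with real rank zero and `I` a closed two-sided
ideal of `A`.  Suppose that for every projection `p ∈ A` with `p ∉ I`, the smallest closed
two-sided ideal of `M(I)` containing `σ(p)` together with `θ(I)` is `M(I)` itself (i.e.
the image of `p` under the Busby invariant is norm-full in the corona algebra `M(I)/I`).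
Then for every `a ∈ A` with `a ∉ I`, the smallest closed two-sided ideal of `M(I)`
containing `σ(a)` together with `θ(I)` is `M(I)` itself; that is, the extension
`0 → I → A → A/I → 0` is full. -/
theorem full_of_projections_full
    {A : Type*} [NonUnitalCStarAlgebra A] (hRR : HasRealRankZero A)
    (S : NonUnitalStarSubalgebra ℂ A) [IsClosed (S : Set A)]
    (hS : ∀ a : A, ∀ x ∈ S, a * x ∈ S ∧ x * a ∈ S)
    (hproj : ∀ p : A, star p = p → p * p = p → p ∉ S →
      closedIdealGeneratedBy
        ({idealMultiplier S hS p} ∪ Set.range (fun b : S => (b : 𝓜(ℂ, S)))) = Set.univ) :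
    ∀ a : A, a ∉ S →
      closedIdealGeneratedBy
        ({idealMultiplier S hS a} ∪ Set.range (fun b : S => (b : 𝓜(ℂ, S)))) = Set.univ := by
  intro a ha
  obtain ⟨δ, hδ, hball⟩ := Metric.isOpen_iff.1
    (IsClosed.isOpen_compl (s := (S : Set A))) a ha
  obtain ⟨p, x, y, c, hp, hpp, hpx, hpa⟩ := hRR.exists_projection a hδ
  have hpS : p ∉ S := fun h =>
    hball (by rwa [Metric.mem_ball, dist_comm, dist_eq_norm]) (hS a p h).1
  refine Set.eq_univ_of_univ_subset ((hproj p hp hpp hpS).symm.le.trans ?_)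
  refine Set.subset_iInter₂ fun J hJ => Set.iInter₂_subset J ⟨hJ.1, Set.union_subset ?_
    (Set.subset_union_right.trans hJ.2)⟩
  have haJ : idealMultiplier S hS a ∈ J := hJ.2 (Or.inl rfl)
  have hσ : idealMultiplier S hS p = idealMultiplier S hS x * idealMultiplier S hS a *
      (algebraMap ℂ 𝓜(ℂ, S) c + idealMultiplier S hS y) := by
    rw [hpx]
    apply DoubleCentralizer.ext
    apply Prod.ext
    · ext z
      simp [idealMultiplier, mul_add, add_mul, mul_assoc, Algebra.algebraMap_eq_smul_one,
        smul_mul_assoc, mul_smul_comm]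
    · ext z
      simp [idealMultiplier, mul_add, add_mul, mul_assoc, Algebra.algebraMap_eq_smul_one,
        smul_mul_assoc, mul_smul_comm]
  rw [Set.singleton_subset_iff, hσ]
  exact J.mul_mem_right _ _ (J.mul_mem_left _ _ haJ)
end
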